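/- Let k ≥ 1, n > k, and let h ∈ ℂ[X₀,…,X_k] be a nonconstant homogeneous polynomial. Suppose (F₀,…,Fₙ) is an endomorphism of ℙⁿ(ℂ) of algebraic degree q ≥ 2 and λ ∈ ℂ∖{0} satisfy h(F₀,…,F_k) = λ·h^q in ℂ[X₀,…,Xₙ]. Then there exist an endomorphism (G₀,…,G_{n−1}) of ℙ^{n−1}(ℂ) of algebraic degree q and λ' ∈ ℂ∖{0} with h(G₀,…,G_k) = λ'·h^q in ℂ[X₀,…,X_{n−1}]. -/

import Mathlib

open MvPolynomial

/-- `F` is an endomorphism of `ℙ^{N-1}(ℂ)` of algebraic degree `q`: a tuple of `N`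
homogeneous polynomials of degree `q` in `N` variables whose only common zero in `ℂ^N`
is the origin. -/
def IsEndo (N q : ℕ) (F : Fin N → MvPolynomial (Fin N) ℂ) : Prop :=
  (∀ i, (F i).IsHomogeneous q) ∧
    ∀ x : Fin N → ℂ, (∀ i, eval x (F i) = 0) → x = 0

/-- The hypersurface `{h = 0} ⊂ ℙ^{N-1}(ℂ)` is totally invariant: there is a non-trivial
endomorphism `F` (of algebraic degree `q ≥ 2`) and `λ ≠ 0` with `h(F₀,…,F_{N-1}) = λ·h^q`. -/
def IsTotallyInvariant (N : ℕ) (h : MvPolynomial (Fin N) ℂ) : Prop :=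
  ∃ q, 2 ≤ q ∧ ∃ F : Fin N → MvPolynomial (Fin N) ℂ, IsEndo N q F ∧
    ∃ lam : ℂ, lam ≠ 0 ∧ aeval F h = C lam * h ^ q

/-- The Jacobian ideal `(h, ∂h/∂X₀, …, ∂h/∂X_{N-1})`. -/
noncomputable def jacobianIdeal (N : ℕ) (h : MvPolynomial (Fin N) ℂ) : Ideal (MvPolynomial (Fin N) ℂ) :=
  Ideal.span (insert h (Set.range fun i => pderiv i h))

theorem finite_of_reduce {N : ℕ} (S : Set (Fin N → ℂ)) (m : Fin N → ℕ)
    (B : Fin N → MvPolynomial (Fin N) ℂ) (hB : ∀ i, (B i).totalDegree < m i)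
    (hS : ∀ x ∈ S, ∀ i, x i ^ m i = eval x (B i)) : S.Finite := by
  classical
  let r : MvPolynomial (Fin N) ℂ →ₐ[ℂ] (S → ℂ) := AlgHom.pi (fun x => aeval x.1)
  have hr : ∀ p x, r p x = eval x.1 p := fun p x => by
    simp [r, aeval_eq_eval]
  let M : Fin N →₀ ℕ := Finsupp.equivFunOnFinite.symm m
  let T : Set (S → ℂ) := (fun s : Fin N →₀ ℕ => r (monomial s 1)) '' (Set.Iic M)
  have hT : T.Finite := (Set.finite_Iic M).image _
  let W : Submodule ℂ (S → ℂ) := Submodule.span ℂ T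
  have key : ∀ D : ℕ, ∀ p : MvPolynomial (Fin N) ℂ, p.totalDegree ≤ D → r p ∈ W := by
    intro D
    induction D using Nat.strong_induction_on with
    | _ D ih =>
      intro p hp
      rw [p.as_sum, map_sum]
      refine Submodule.sum_mem _ fun s hs => ?_
      have hsD : (s.sum fun _ e => e) ≤ D := (le_totalDegree hs).trans hp
      have e1 : monomial s (coeff s p) = coeff s p • monomial s (1 : ℂ) := by
        simp [smul_monomial]
      rw [e1, map_smul]
      refine W.smul_mem _ ?_
      by_cases hsM : s ≤ M
      · exact Submodule.subset_span ⟨s, hsM, rfl⟩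
      · obtain ⟨i, hi⟩ : ∃ i, m i < s i := by
          by_contra hcon
          push Not at hcon
          exact hsM hcon
        have hle : Finsupp.single i (m i) ≤ s := by
          rw [Finsupp.single_le_iff]; exact hi.le
        obtain ⟨t, rfl⟩ := exists_add_of_le hle
        have e2 : r (monomial (Finsupp.single i (m i) + t) 1) = r (B i * monomial t 1) := by
          funext x
          rw [hr, hr, map_mul, ← hS x.1 x.2 i, ← mul_one (1 : ℂ), ← monomial_mul, map_mul]
          simp [eval_monomial]
        rw [e2]
        have hdeg : (B i * monomial t (1 : ℂ)).totalDegree < D := by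
          refine (totalDegree_mul _ _).trans_lt ?_
          rw [totalDegree_monomial t one_ne_zero]
          rw [Finsupp.sum_add_index' (by simp) (by simp), Finsupp.sum_single_index rfl] at hsD
          have := hB i
          omega
        exact ih _ hdeg _ le_rfl
  have hfin : W.FG := ⟨hT.toFinset, by simp [W]⟩
  have hint : ∀ i, IsIntegral ℂ (r (X i)) := by
    intro i
    refine IsIntegral.of_mem_of_fg r.range ?_ _ ⟨X i, rfl⟩
    have : Subalgebra.toSubmodule r.range = W := by
      apply le_antisymm
      · rintro _ ⟨p, rfl⟩
        exact key _ p le_rfl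
      · refine Submodule.span_le.2 ?_
        rintro _ ⟨s, _, rfl⟩
        exact ⟨_, rfl⟩
    rw [this]; exact hfin
  choose P hPm hP using hint
  refine (Set.Finite.pi (t := fun i => {z : ℂ | (P i).IsRoot z}) (fun i => ?_)).subset ?_
  · exact Polynomial.finite_setOfPred_isRoot (hPm i).ne_zero
  · intro x hx i _
    have h1 : (Polynomial.aeval (r (X i))) (P i) = 0 := hP i
    have h2 := congrArg (Pi.evalAlgHom ℂ (fun _ : S => ℂ) ⟨x, hx⟩) h1
    rw [← Polynomial.aeval_algHom_apply] at h2
    simpa [hr, Polynomial.IsRoot] using h2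

theorem exists_reduce {N q : ℕ} (hq : 2 ≤ q) (F : Fin (N+1) → MvPolynomial (Fin (N+1)) ℂ)
    (hF : IsEndo (N+1) q F) (i : Fin (N+1)) :
    ∃ (m : ℕ) (A : Fin (N+1) → MvPolynomial (Fin (N+1)) ℂ),
      (∀ j, (A j).totalDegree < m) ∧ X i ^ m = ∑ j, A j * F j := by
  classical
  let I : Ideal (MvPolynomial (Fin (N+1)) ℂ) := Ideal.span (Set.range F)
  have h1 : X i ∈ I.radical := by
    rw [← vanishingIdeal_zeroLocus_eq_radical (K := ℂ)]
    intro x hx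
    have : x = 0 := hF.2 x fun j => by
      have := hx (F j) (Ideal.subset_span ⟨j, rfl⟩)
      simpa [aeval_eq_eval] using this
    simp [this]
  obtain ⟨m0, hm0⟩ := h1
  have hm : X i ^ (m0 + q) ∈ I := by
    rw [pow_add]; exact I.mul_mem_right _ hm0
  obtain ⟨A, hA⟩ := (Ideal.mem_span_range_iff_exists_fun).1 hm
  refine ⟨m0 + q, fun j => homogeneousComponent (m0 + q - q) (A j), fun j => ?_, ?_⟩
  · refine ((homogeneousComponent_isHomogeneous _ _).totalDegree_le).trans_lt (by omega)
  · have h2 := congrArg (homogeneousComponent (m0 + q)) hA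
    rw [map_sum, homogeneousComponent_of_mem (isHomogeneous_X_pow i (m0+q)), if_pos rfl] at h2
    rw [← h2]
    refine Finset.sum_congr rfl fun j _ => ?_
    let _ : GradedAlgebra (homogeneousSubmodule (Fin (N+1)) ℂ) := MvPolynomial.gradedAlgebra
    have := DirectSum.coe_decompose_mul_of_right_mem_of_le
      (homogeneousSubmodule (Fin (N+1)) ℂ) (a := A j) (b := F j) (i := q) (n := m0 + q)
      (hF.1 j) (by omega)
    have e : ∀ p k, ((DirectSum.decompose (homogeneousSubmodule (Fin (N+1)) ℂ) p k :
      homogeneousSubmodule (Fin (N+1)) ℂ k) : MvPolynomial (Fin (N+1)) ℂ)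
      = homogeneousComponent k p := fun p k => decomposition.decompose'_apply p k
    rw [e, e] at this
    exact this

theorem fiber_finite {N q : ℕ} (hq : 2 ≤ q) (F : Fin (N+1) → MvPolynomial (Fin (N+1)) ℂ)
    (hF : IsEndo (N+1) q F) :
    {x : Fin (N+1) → ℂ | (∀ j : Fin N, eval x (F j.castSucc) = 0) ∧
      eval x (F (Fin.last N)) = 1}.Finite := by
  choose m A hA hX using exists_reduce hq F hF
  refine finite_of_reduce _ m (fun i => A i (Fin.last N)) (fun i => hA i _) ?_
  rintro x ⟨h0, h1⟩ i
  have := congrArg (eval x) (hX i)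
  simpa [Fin.sum_univ_castSucc, h0, h1] using this

theorem exists_hyperplane {n : ℕ} (S : Set (Fin (n+1) → ℂ)) (hS : S.Finite)
    (h0 : ∀ x ∈ S, x ≠ 0) :
    ∃ a : Fin n → ℂ, ∀ x ∈ S, x (Fin.last n) ≠ ∑ i, a i * x i.castSucc := by
  classical
  let P : (Fin (n+1) → ℂ) → MvPolynomial (Fin n) ℂ := fun x =>
    C (x (Fin.last n)) - ∑ i, X i * C (x i.castSucc)
  have hev : ∀ x a, eval a (P x) = x (Fin.last n) - ∑ i, a i * x i.castSucc := by
    intro x a; simp [P]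
  have hP : ∀ x ∈ S, P x ≠ 0 := by
    intro x hx hz
    apply h0 x hx
    have e0 : x (Fin.last n) = 0 := by
      have := hev x 0
      simpa [hz] using this.symm
    funext j
    refine Fin.lastCases e0 (fun i => ?_) j
    have := hev x (Pi.single i 1)
    simpa [hz, e0, Pi.single_apply] using this.symm
  have hprod : ∏ x ∈ hS.toFinset, P x ≠ 0 :=
    Finset.prod_ne_zero_iff.2 fun x hx => hP x (hS.mem_toFinset.1 hx)
  obtain ⟨a, ha⟩ : ∃ a, eval a (∏ x ∈ hS.toFinset, P x) ≠ 0 := by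
    by_contra hcon
    push Not at hcon
    exact hprod (MvPolynomial.funext fun a => by simpa using hcon a)
  refine ⟨a, fun x hx he => ha ?_⟩
  rw [map_prod]
  exact Finset.prod_eq_zero (hS.mem_toFinset.2 hx) (by rw [hev, he, sub_self])

theorem eval_smul_hom {N q : ℕ} {p : MvPolynomial (Fin N) ℂ} (hp : p.IsHomogeneous q)
    (c : ℂ) (x : Fin N → ℂ) : eval (c • x) p = c ^ q * eval x p := by
  rw [eval_eq, eval_eq, Finset.mul_sum]
  refine Finset.sum_congr rfl fun s hs => ?_
  have h1 : s.degree = q := by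
    rw [Finsupp.degree_eq_weight_one]; exact hp (mem_support_iff.1 hs)
  simp only [Pi.smul_apply, smul_eq_mul, mul_pow, Finset.prod_mul_distrib,
    Finset.prod_pow_eq_pow_sum]
  rw [← h1, Finsupp.degree_apply]
  ring

/-- Induction step for Theorem B: if the cone of `ℙⁿ` over `{h = 0} ⊂ ℙᵏ` (with `n > k`) is
totally invariant under an endomorphism of algebraic degree `q ≥ 2`, then the cone of
`ℙ^{n-1}` over `{h = 0}` is totally invariant under some endomorphism of algebraic degree `q`. -/
theorem cone_descent (k n : ℕ) (hk : 1 ≤ k) (hkn : k < n)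
    (h : MvPolynomial (Fin (k + 1)) ℂ) (d : ℕ) (hd : d ≠ 0) (hne : h ≠ 0)
    (hhom : h.IsHomogeneous d)
    (q : ℕ) (hq : 2 ≤ q) (F : Fin (n + 1) → MvPolynomial (Fin (n + 1)) ℂ)
    (hF : IsEndo (n + 1) q F) (lam : ℂ) (hlam : lam ≠ 0)
    (heq : aeval (fun i : Fin (k + 1) => F (Fin.castLE (by omega : k + 1 ≤ n + 1) i)) h =
      C lam * (rename (Fin.castLE (by omega : k + 1 ≤ n + 1)) h) ^ q) :
    ∃ G : Fin n → MvPolynomial (Fin n) ℂ, IsEndo n q G ∧ ∃ lam' : ℂ, lam' ≠ 0 ∧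
      aeval (fun i : Fin (k + 1) => G (Fin.castLE (by omega : k + 1 ≤ n) i)) h =
        C lam' * (rename (Fin.castLE (by omega : k + 1 ≤ n)) h) ^ q := by
  have hfin := fiber_finite hq F hF
  obtain ⟨a, ha⟩ := exists_hyperplane _ hfin (by
    rintro x ⟨_, h1⟩ rfl
    have h2 := eval_smul_hom (hF.1 (Fin.last n)) 0 0
    rw [smul_zero, h1, zero_pow (by omega)] at h2
    simp at h2)
  let g : Fin (n + 1) → MvPolynomial (Fin n) ℂ :=
    Fin.snoc (α := fun _ => MvPolynomial (Fin n) ℂ) X (∑ i, C (a i) * X i)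
  have hg : ∀ i, (g i).IsHomogeneous 1 := by
    intro i
    refine Fin.lastCases ?_ (fun i => ?_) i
    · simp only [g, Fin.snoc_last]
      refine IsHomogeneous.sum _ _ _ fun i _ => ?_
      exact (isHomogeneous_X ℂ i).C_mul (a i)
    · simp only [g, Fin.snoc_castSucc]
      exact isHomogeneous_X ℂ i
  have hcast : ∀ i : Fin (k + 1), Fin.castLE (by omega : k + 1 ≤ n + 1) i =
      (Fin.castLE (by omega : k + 1 ≤ n) i).castSucc := fun i => rfl
  refine ⟨fun i => aeval g (F i.castSucc), ⟨fun i => ?_, fun y hy => ?_⟩, lam, hlam, ?_⟩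
  · simpa using (hF.1 i.castSucc).aeval g hg
  · let x : Fin (n + 1) → ℂ := fun i => eval y (g i)
    have hx1 : ∀ i : Fin n, x i.castSucc = y i := by intro i; simp [x, g]
    have hx2 : x (Fin.last n) = ∑ i, a i * x i.castSucc := by simp [x, g]
    have hev : ∀ p, eval y (aeval g p) = eval x p := by
      intro p
      have : (aeval y : MvPolynomial (Fin n) ℂ →ₐ[ℂ] ℂ).comp (aeval g) = aeval x := by
        apply MvPolynomial.algHom_ext
        intro i
        simp [x, aeval_eq_eval]
      have := DFunLike.congr_fun this p
      simpa [aeval_eq_eval] using this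
    have hz : ∀ i : Fin n, eval x (F i.castSucc) = 0 := fun i => by
      rw [← hev]; exact hy i
    by_cases hv : eval x (F (Fin.last n)) = 0
    · have hx0 : x = 0 := hF.2 x fun i => by
        refine Fin.lastCases hv hz i
      funext i
      rw [← hx1, hx0]; rfl
    · exfalso
      obtain ⟨c, hc⟩ := IsAlgClosed.exists_pow_nat_eq (eval x (F (Fin.last n)))⁻¹
        (by omega : 0 < q)
      refine ha (c • x) ⟨fun j => ?_, ?_⟩ ?_
      · rw [eval_smul_hom (hF.1 _), hz, mul_zero]
      · rw [eval_smul_hom (hF.1 _), hc, inv_mul_cancel₀ hv]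
      · simp only [Pi.smul_apply, smul_eq_mul]
        rw [hx2, Finset.mul_sum]
        exact Finset.sum_congr rfl fun i _ => by ring
  · have h1 := congrArg (aeval g) heq
    rw [map_mul, map_pow, aeval_rename, ← AlgHom.comp_apply, comp_aeval] at h1
    have e3 : (g ∘ Fin.castLE (by omega : k + 1 ≤ n + 1)) =
        fun i : Fin (k + 1) => X (Fin.castLE (by omega : k + 1 ≤ n) i) := by
      funext i
      simp only [Function.comp, hcast, g, Fin.snoc_castSucc]
    rw [e3, aeval_C] at h1
    have e4 : (aeval fun i : Fin (k + 1) => (X (Fin.castLE (by omega : k + 1 ≤ n) i) :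
        MvPolynomial (Fin n) ℂ)) h = rename (Fin.castLE (by omega : k + 1 ≤ n)) h := by
      rw [rename_eq_aeval]; rfl
    rw [e4] at h1
    exact h1
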